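/- (Generalization bound under the universal-style prior, prefix-description form) Let Z be a measurable space, μ a probability measure on Z, H a type of hypotheses, ℓ : H → Z → ℝ a loss function measurable in z with 0 ≤ ℓ h z ≤ 1, and let d : List Bool → Option H be a description system whose support {s | d s ≠ none} is a prefix-free set of bitstrings. Fix n ≥ 1 and δ ∈ (0, 1]. Then with probability at least 1 − δ over a sample z = (z_1, …, z_n) drawn from the n-fold product measure μ^n, simultaneously for every bitstring s and hypothesis h with d s = some h, R(h) ≤ R̂(h, z) + √((s.length · ln 2 + ln(1/δ)) / (2n)). In words, hypotheses with short prefix-free descriptions provably generalize. -/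

import Mathlib

open MeasureTheory

/-- A set of bitstrings is prefix-free if no element is a proper prefix of a different
element, i.e. any prefix relation within the set forces equality. -/
def PrefixFree (S : Set (List Bool)) : Prop :=
  ∀ s ∈ S, ∀ t ∈ S, s <+: t → s = t

open ProbabilityTheory InformationTheory

lemma PrefixFree.uniquelyDecodable {S : Set (List Bool)} (hS : PrefixFree S) (hnil : [] ∉ S) :
    UniquelyDecodable S := by
  intro L₁
  induction L₁ with
  | nil =>
    intro L₂ _ h₂ h
    cases L₂ with
    | nil => rfl
    | cons b L₂ =>
      have hb : b = [] := by simp_all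
      exact absurd (hb ▸ h₂ b (by simp)) hnil
  | cons a L₁ ih =>
    intro L₂ h₁ h₂ h
    cases L₂ with
    | nil =>
      have ha : a = [] := by simp_all
      exact absurd (ha ▸ h₁ a (by simp)) hnil
    | cons b L₂ =>
      have ha := h₁ a (by simp)
      have hb := h₂ b (by simp)
      rw [List.flatten_cons, List.flatten_cons] at h
      have hab : a = b := by
        rcases List.prefix_or_prefix_of_prefix (List.prefix_append a L₁.flatten)
          (h ▸ List.prefix_append b L₂.flatten) with hp | hp
        · exact hS a ha b hb hp
        · exact (hS b hb a ha hp).symm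
      subst hab
      rw [ih L₂ (fun w hw => h₁ w (by simp [hw])) (fun w hw => h₂ w (by simp [hw]))
        (List.append_cancel_left h)]

/-- **Kraft's inequality** for finite prefix-free sets of bitstrings. -/
lemma PrefixFree.sum_two_inv_pow_length_le_one {S : Finset (List Bool)}
    (hS : PrefixFree (S : Set (List Bool))) :
    ∑ s ∈ S, (1 / 2 : ℝ) ^ s.length ≤ 1 := by
  by_cases hnil : [] ∈ S
  · have hS' : S = {[]} :=
      Finset.eq_singleton_iff_unique_mem.2
        ⟨hnil, fun t ht => (hS [] hnil t ht List.nil_prefix).symm⟩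
    simp [hS']
  · simpa using kraft_mcmillan_inequality (hS.uniquelyDecodable (by simpa using hnil))

lemma PrefixFree.tsum_ofReal_mul_two_inv_pow_length_le {S : Set (List Bool)}
    (hS : PrefixFree S) {δ : ℝ} (hδ : 0 ≤ δ) :
    ∑' s : S, ENNReal.ofReal (δ * (1 / 2) ^ (s : List Bool).length) ≤ ENNReal.ofReal δ := by
  rw [ENNReal.tsum_eq_iSup_sum]
  refine iSup_le fun F => ?_
  rw [← ENNReal.ofReal_sum_of_nonneg fun _ _ => by positivity, ← Finset.mul_sum]
  refine ENNReal.ofReal_le_ofReal (mul_le_of_le_one_right hδ ?_)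
  have hF : PrefixFree (F.map (Function.Embedding.subtype (· ∈ S)) : Set (List Bool)) := by
    intro s hs t ht
    simp only [Finset.coe_map, Set.mem_image] at hs ht
    obtain ⟨s, -, rfl⟩ := hs
    obtain ⟨t, -, rfl⟩ := ht
    exact hS s s.2 t t.2
  simpa using hF.sum_two_inv_pow_length_le_one

/-- **Hoeffding's inequality** for the empirical mean of a `[0, 1]`-valued function, with the
deviation expressed through the logarithm `L` of the inverse failure probability. -/
lemma measure_empirical_mean_add_sqrt_lt_integral_le {Z : Type*} [MeasurableSpace Z]
    (μ : Measure Z) [IsProbabilityMeasure μ] {f : Z → ℝ} (hf : Measurable f)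
    (hf01 : ∀ z, f z ∈ Set.Icc (0 : ℝ) 1) {n : ℕ} (hn : 1 ≤ n) {L : ℝ} (hL : 0 ≤ L) :
    (Measure.pi fun _ : Fin n => μ)
        {z | (1 / (n : ℝ)) * ∑ i, f (z i) + Real.sqrt (L / (2 * (n : ℝ))) < ∫ x, f x ∂μ} ≤
      ENNReal.ofReal (Real.exp (-L)) := by
  have hn0 : (0 : ℝ) < n := by exact_mod_cast hn
  let g : Z → ℝ := fun z => -(f z - ∫ x, f x ∂μ)
  have hg : Measurable g := (hf.sub_const _).neg
  have hsub : HasSubgaussianMGF g ((‖(1 : ℝ) - 0‖₊ / 2) ^ 2) μ :=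
    (hasSubgaussianMGF_of_mem_Icc hf.aemeasurable (ae_of_all _ hf01)).neg
  have hindep : iIndepFun (fun (i : Fin n) (z : Fin n → Z) => g (z i))
      (Measure.pi fun _ : Fin n => μ) :=
    iIndepFun_pi fun _ => hg.aemeasurable
  have hsub' (i : Fin n) : HasSubgaussianMGF (fun z : Fin n → Z => g (z i))
      ((‖(1 : ℝ) - 0‖₊ / 2) ^ 2) (Measure.pi fun _ : Fin n => μ) := by
    have hmp := measurePreserving_eval (fun _ : Fin n => μ) i
    refine HasSubgaussianMGF.of_map (Y := fun z : Fin n → Z => z i) (X := g)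
      hmp.measurable.aemeasurable ?_
    have hmap : (Measure.pi fun _ : Fin n => μ).map (fun z => z i) = μ := hmp.map_eq
    rwa [hmap]
  have hoeff := HasSubgaussianMGF.measure_sum_ge_le_of_iIndepFun hindep (s := Finset.univ)
    (fun i _ => hsub' i) (ε := n * Real.sqrt (L / (2 * n))) (by positivity)
  have hexp : -(n * Real.sqrt (L / (2 * n))) ^ 2 /
      (2 * ((∑ _i : Fin n, (‖(1 : ℝ) - 0‖₊ / 2) ^ 2 : NNReal) : ℝ)) = -L := by
    rw [mul_pow, Real.sq_sqrt (by positivity)]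
    simp
    field_simp
  rw [hexp] at hoeff
  rw [← ofReal_measureReal]
  refine ENNReal.ofReal_le_ofReal (le_trans (measureReal_mono fun z hz => ?_) hoeff)
  simp only [Set.mem_ofPred_eq] at hz ⊢
  have hsum : ∑ i, g (z i) = n * ∫ x, f x ∂μ - ∑ i, f (z i) := by simp [g]
  have hmul := mul_lt_mul_of_pos_left hz hn0
  rw [mul_add, ← mul_assoc, mul_one_div_cancel hn0.ne', one_mul] at hmul
  linarith

/-- Generalization bound under the universal-style prior (prefix-description form): for a
description system `d` for hypotheses whose support is prefix-free and a `[0, 1]`-valued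
loss `ℓ`, with probability at least `1 - δ` over an i.i.d. sample `z` of size `n` from
`μ`, simultaneously every bitstring `s` describing a hypothesis `h` satisfies
`R(h) ≤ R̂(h, z) + √((|s|·ln 2 + ln (1 / δ)) / (2n))`. -/
theorem stmt_13 {Z : Type*} [MeasurableSpace Z] (μ : Measure Z)
    [IsProbabilityMeasure μ] {H : Type*}
    (ℓ : H → Z → ℝ) (hmeas : ∀ h, Measurable (ℓ h))
    (hbound : ∀ h z, 0 ≤ ℓ h z ∧ ℓ h z ≤ 1)
    (d : List Bool → Option H) (hD : PrefixFree {s : List Bool | d s ≠ none})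
    (n : ℕ) (hn : 1 ≤ n) (δ : ℝ) (hδ0 : 0 < δ) (hδ1 : δ ≤ 1) :
    ENNReal.ofReal (1 - δ) ≤
      (Measure.pi fun _ : Fin n => μ)
        {z : Fin n → Z | ∀ (s : List Bool) (h : H), d s = some h →
          ∫ x, ℓ h x ∂μ ≤ (1 / (n : ℝ)) * ∑ i, ℓ h (z i) +
            Real.sqrt (((s.length : ℝ) * Real.log 2 + Real.log (1 / δ))
              / (2 * (n : ℝ)))} := by
  set A := {z : Fin n → Z | ∀ (s : List Bool) (h : H), d s = some h →
    ∫ x, ℓ h x ∂μ ≤ (1 / (n : ℝ)) * ∑ i, ℓ h (z i) +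
      Real.sqrt (((s.length : ℝ) * Real.log 2 + Real.log (1 / δ)) / (2 * (n : ℝ)))} with hA
  set P := Measure.pi fun _ : Fin n => μ
  have hlog : 0 ≤ Real.log (1 / δ) := Real.log_nonneg (one_le_one_div hδ0 hδ1)
  let S := {s : List Bool | d s ≠ none}
  have hS (s : S) : ∃ h, d s = some h := Option.ne_none_iff_exists'.1 s.2
  choose hyp hhyp using hS
  have hcompl : P Aᶜ ≤ ENNReal.ofReal δ := by
    refine le_trans ?_ (hD.tsum_ofReal_mul_two_inv_pow_length_le hδ0.le)
    refine le_trans (measure_mono (t := ⋃ s : S, {z | (1 / (n : ℝ)) * ∑ i, ℓ (hyp s) (z i) +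
      Real.sqrt ((((s : List Bool).length : ℝ) * Real.log 2 + Real.log (1 / δ)) /
        (2 * (n : ℝ))) < ∫ x, ℓ (hyp s) x ∂μ}) fun z hz => ?_)
      ((measure_iUnion_le _).trans (ENNReal.tsum_le_tsum fun s => ?_))
    · simp only [hA, Set.mem_compl_iff, Set.mem_ofPred_eq, not_forall, not_le] at hz
      obtain ⟨s, h, hs, hlt⟩ := hz
      have hmem : s ∈ S := by simp [S, hs]
      have heq : hyp ⟨s, hmem⟩ = h := Option.some_injective _ ((hhyp ⟨s, hmem⟩).symm.trans hs)
      exact Set.mem_iUnion.2 ⟨⟨s, hmem⟩, by simpa only [Set.mem_ofPred_eq, heq] using hlt⟩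
    · refine (measure_empirical_mean_add_sqrt_lt_integral_le μ (hmeas (hyp s))
        (hbound (hyp s)) hn (by positivity)).trans_eq ?_
      congr 1
      rw [neg_add, Real.exp_add, ← Real.log_inv, Real.exp_log (by positivity), ← mul_neg,
        ← Real.log_inv, Real.exp_nat_mul, Real.exp_log (by positivity)]
      simp [mul_comm]
  rw [ENNReal.ofReal_sub _ hδ0.le, ENNReal.ofReal_one, tsub_le_iff_right]
  calc (1 : ENNReal) = P Set.univ := measure_univ.symm
    _ ≤ P A + P Aᶜ := by
      rw [← Set.union_compl_self A]
      exact measure_union_le _ _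
    _ ≤ P A + ENNReal.ofReal δ := by gcongr
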